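/- arXiv:2111.02530 — 4 statements merged into one kernel-verified Lean document; each statement's English description precedes it below -/
import Mathlib

section
/- Let id denote the identity bijection of ℤ. For every k ≥ 1 and all integers z_1, …, z_k one has W_{(z_k,z_k+1)} ∘ ⋯ ∘ W_{(z_2,z_2+1)} ∘ W_{(z_1,z_1+1)} (id) = inv( W_{(z_1,z_1+1)} ∘ W_{(z_2,z_2+1)} ∘ ⋯ ∘ W_{(z_k,z_k+1)} (id) ), where on the right-hand side inv denotes the operation of taking the inverse of a bijection of ℤ. (In each composition the rightmost operator is applied first, so the left-hand side applies W_{(z_1,z_1+1)} first and the right-hand side applies W_{(z_k,z_k+1)} first.) -/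
/-- The totally asymmetric swap operator `W_{(z,z+1)}` acting on bijections of `ℤ`:
it exchanges the values at positions `z` and `z+1` (i.e. precomposes with the
transposition of `z` and `z+1`) if the value at `z` is smaller than the value at
`z+1`, and does nothing otherwise. -/
noncomputable def W (z : ℤ) (η : Equiv.Perm ℤ) : Equiv.Perm ℤ :=
  if η z < η (z + 1) then (Equiv.swap z (z + 1)).trans η else η

/-- Applying the word `[z_1, …, z_k]` of swap operators to a bijection, the
leftmost letter `z_1` acting first: `W_{(z_k,z_k+1)} ∘ ⋯ ∘ W_{(z_1,z_1+1)}`. -/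
noncomputable def applyWord (l : List ℤ) (η : Equiv.Perm ℤ) : Equiv.Perm ℤ :=
  l.foldl (fun η z => W z η) η

/-- The left (color) version of the swap operator. -/
noncomputable def Lop (z : ℤ) (η : Equiv.Perm ℤ) : Equiv.Perm ℤ := (W z η⁻¹)⁻¹

theorem W_def' (z : ℤ) (η : Equiv.Perm ℤ) :
    W z η = if η z < η (z + 1) then η * Equiv.swap z (z + 1) else η := rfl

theorem Lop_def (z : ℤ) (η : Equiv.Perm ℤ) :
    Lop z η = if η⁻¹ z < η⁻¹ (z + 1) then Equiv.swap z (z + 1) * η else η := by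
  unfold Lop
  rw [W_def']
  split_ifs <;> simp

theorem swap_lt (b x y : ℤ) (h1 : ¬ (x = b ∧ y = b + 1)) (h2 : ¬ (x = b + 1 ∧ y = b)) :
    Equiv.swap b (b + 1) x < Equiv.swap b (b + 1) y ↔ x < y := by
  simp only [Equiv.swap_apply_def]
  split_ifs <;> omega

theorem comm_WL (a b : ℤ) (η : Equiv.Perm ℤ) : W a (Lop b η) = Lop b (W a η) := by
  by_cases h1 : η a = b ∧ η (a + 1) = b + 1
  · obtain ⟨h, h'⟩ := h1
    have e : η⁻¹ b = a := by rw [← h]; simp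
    have e' : η⁻¹ (b + 1) = a + 1 := by rw [← h']; simp
    have key : η * Equiv.swap a (a + 1) = Equiv.swap b (b + 1) * η := by
      rw [← h', ← h, Equiv.swap_apply_apply]; simp
    have hL : Lop b η = Equiv.swap b (b + 1) * η := by
      rw [Lop_def, e, e', if_pos (by omega)]
    have hW : W a η = Equiv.swap b (b + 1) * η := by
      rw [W_def', h, h', if_pos (by omega), key]
    rw [hL, hW, W_def', Lop_def, if_neg, if_neg]
    · simp only [mul_inv_rev, Equiv.swap_inv, Equiv.Perm.mul_apply, Equiv.swap_apply_left,
        Equiv.swap_apply_right, e, e']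
      omega
    · simp [h, h']
  by_cases h2 : η a = b + 1 ∧ η (a + 1) = b
  · obtain ⟨h, h'⟩ := h2
    have e : η⁻¹ (b + 1) = a := by rw [← h]; simp
    have e' : η⁻¹ b = a + 1 := by rw [← h']; simp
    have hL : Lop b η = η := by
      rw [Lop_def, e, e', if_neg (by omega)]
    have hW : W a η = η := by
      rw [W_def', h, h', if_neg (by omega)]
    rw [hL, hW, hL]
  have g1 := swap_lt b (η a) (η (a + 1)) h1 h2
  have g2 := swap_lt a (η⁻¹ b) (η⁻¹ (b + 1))
    (by rintro ⟨p, q⟩; exact h1 ⟨by rw [← p]; simp, by rw [← q]; simp⟩)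
    (by rintro ⟨p, q⟩; exact h2 ⟨by rw [← q]; simp, by rw [← p]; simp⟩)
  rw [W_def' a η, Lop_def b η]
  by_cases c1 : η a < η (a + 1) <;> by_cases c2 : η⁻¹ b < η⁻¹ (b + 1) <;>
    simp only [c1, c2, if_true, if_false, W_def', Lop_def, Equiv.Perm.mul_apply, mul_inv_rev,
      Equiv.swap_inv, g1, g2, mul_assoc]

theorem applyWord_Lop (b : ℤ) (l : List ℤ) (η : Equiv.Perm ℤ) :
    applyWord l (Lop b η) = Lop b (applyWord l η) := by
  induction l generalizing η with
  | nil => rfl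
  | cons a l ih =>
    change applyWord l (W a (Lop b η)) = Lop b (applyWord l (W a η))
    rw [comm_WL, ih]

theorem W_one (a : ℤ) : W a 1 = Lop a 1 := by
  rw [W_def', Lop_def]; simp

theorem symm_list (l : List ℤ) : applyWord l 1 = (applyWord l.reverse 1)⁻¹ := by
  induction l with
  | nil => simp [applyWord]
  | cons a l ih =>
    have h : applyWord (a :: l).reverse 1 = W a (applyWord l.reverse 1) := by
      simp [applyWord]
    rw [h]
    change applyWord l (W a 1) = _
    rw [W_one, applyWord_Lop, ih, Lop, inv_inv]

/-- Color-position symmetry: for any `k ≥ 1` and integers `z_1, …, z_k`,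
`W_{(z_k,z_k+1)} ⋯ W_{(z_1,z_1+1)} (id) = inv (W_{(z_1,z_1+1)} ⋯ W_{(z_k,z_k+1)} (id))`,
where on the left `z_1` acts first and on the right `z_k` acts first. -/
theorem color_position_symmetry (k : ℕ) (hk : 1 ≤ k) (z : Fin k → ℤ) :
    applyWord (List.ofFn z) 1 = (applyWord (List.ofFn z).reverse 1)⁻¹ := by
  exact symm_list _
end

section
/- Let a < b be real numbers and let C([a,b], ℝ) denote the space of continuous real-valued functions on [a,b] equipped with the supremum metric. Let (μ_n) be probability measures on C([a,b], ℝ) converging weakly to a probability measure μ. Let g_n, g : [a,b] → ℝ be bounded functions such that g_n converges to g uniformly on [a,b]. For a bounded function h : [a,b] → ℝ, define the map F_h : C([a,b], ℝ) → ℝ by F_h(X) = sup_{τ ∈ [a,b]} ( X(τ) − h(τ) ); this map is 1-Lipschitz with respect to the supremum metric. Then the pushforward measures μ_n ∘ F_{g_n}⁻¹ on ℝ converge weakly to μ ∘ F_g⁻¹. In particular, if X_n are random elements of C([a,b], ℝ) converging weakly to X, then sup_{τ ∈ [a,b]} ( X_n(τ) − g_n(τ) ) converges in distribution to sup_{τ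 ∈ [a,b]} ( X(τ) − g(τ) ). -/
open MeasureTheory Filter Topology BoundedContinuousFunction

/-- Borel σ-algebra on the space `C([a,b], ℝ)` of continuous functions with the
supremum metric. -/
instance instMeasC (a b : ℝ) : MeasurableSpace C(Set.Icc a b, ℝ) := borel _

instance instBorelC (a b : ℝ) : BorelSpace C(Set.Icc a b, ℝ) := ⟨rfl⟩

/-- For a bounded `h : [a,b] → ℝ`, the map `F_h(X) = sup_{τ ∈ [a,b]} (X(τ) − h(τ))`
on continuous functions `X ∈ C([a,b], ℝ)`. -/
noncomputable def supFunctional {a b : ℝ} (h : Set.Icc a b → ℝ)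
    (X : C(Set.Icc a b, ℝ)) : ℝ :=
  ⨆ τ : Set.Icc a b, (X τ - h τ)

theorem supF_bdd {a b : ℝ} {h : Set.Icc a b → ℝ} (hb : ∃ M : ℝ, ∀ τ, |h τ| ≤ M)
    (X : C(Set.Icc a b, ℝ)) : BddAbove (Set.range fun τ => X τ - h τ) := by
  obtain ⟨M, hM⟩ := hb
  refine ⟨‖X‖ + M, ?_⟩
  rintro _ ⟨τ, rfl⟩
  have h1 := (abs_le.1 (X.norm_coe_le_norm τ)).2
  have h2 := (abs_le.1 (hM τ)).1
  show X τ - h τ ≤ _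
  linarith

theorem supF_le {a b : ℝ} (hab : a < b) {h k : Set.Icc a b → ℝ}
    (hk : ∃ M : ℝ, ∀ τ, |k τ| ≤ M)
    (X Y : C(Set.Icc a b, ℝ)) (c : ℝ) (hc : ∀ τ, X τ - h τ ≤ Y τ - k τ + c) :
    supFunctional h X ≤ supFunctional k Y + c := by
  have : Nonempty (Set.Icc a b) := ⟨⟨a, le_refl a, hab.le⟩⟩
  refine ciSup_le fun τ => (hc τ).trans ?_
  have := le_ciSup (supF_bdd hk Y) τ
  unfold supFunctional
  linarith

theorem supF_lip {a b : ℝ} (hab : a < b) {h : Set.Icc a b → ℝ}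
    (hh : ∃ M : ℝ, ∀ τ, |h τ| ≤ M) : LipschitzWith 1 (supFunctional h) := by
  refine LipschitzWith.of_le_add fun X Y => ?_
  refine supF_le hab hh X Y _ fun τ => ?_
  have h1 := ContinuousMap.dist_apply_le_dist (f := X) (g := Y) τ
  rw [Real.dist_eq] at h1
  have := (abs_le.1 h1).2
  linarith

theorem supF_close {a b : ℝ} (hab : a < b) {h k : Set.Icc a b → ℝ}
    (hh : ∃ M : ℝ, ∀ τ, |h τ| ≤ M) (hk : ∃ M : ℝ, ∀ τ, |k τ| ≤ M)
    (X : C(Set.Icc a b, ℝ)) (c : ℝ) (hc : ∀ τ, dist (k τ) (h τ) ≤ c) :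
    dist (supFunctional h X) (supFunctional k X) ≤ c := by
  simp only [Real.dist_eq] at hc
  rw [Real.dist_eq, abs_le]
  have h1 := supF_le hab hk (h := h) X X c fun τ => by
    have := (abs_le.1 (hc τ)).2; linarith
  have h2 := supF_le hab hh (h := k) X X c fun τ => by
    have := (abs_le.1 (hc τ)).1; linarith
  constructor <;> linarith

/-- If probability measures `μ_n` on `C([a,b],ℝ)` converge weakly to `μ`, and bounded
functions `g_n` converge uniformly to the bounded function `g`, then the pushforwards
of `μ_n` under `F_{g_n}` converge weakly (tested against all bounded continuous
functions `φ : ℝ → ℝ`) to the pushforward of `μ` under `F_g`; i.e. if `X_n ⇒ X` then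
`sup_τ (X_n(τ) − g_n(τ))` converges in distribution to `sup_τ (X(τ) − g(τ))`. -/
theorem sup_functional_weak_convergence (a b : ℝ) (hab : a < b)
    (μs : ℕ → ProbabilityMeasure C(Set.Icc a b, ℝ))
    (μ : ProbabilityMeasure C(Set.Icc a b, ℝ))
    (hweak : Tendsto μs atTop (𝓝 μ))
    (gs : ℕ → Set.Icc a b → ℝ) (g : Set.Icc a b → ℝ)
    (hgs_bdd : ∀ n, ∃ M : ℝ, ∀ τ, |gs n τ| ≤ M)
    (hg_bdd : ∃ M : ℝ, ∀ τ, |g τ| ≤ M)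
    (hunif : TendstoUniformly gs g atTop) :
    ∀ φ : ℝ →ᵇ ℝ,
      Tendsto (fun n => ∫ X, φ (supFunctional (gs n) X) ∂(μs n : Measure _))
        atTop (𝓝 (∫ X, φ (supFunctional g X) ∂(μ : Measure _))) := by
  have hF : ∀ n, LipschitzWith 1 (supFunctional (gs n)) := fun n => supF_lip hab (hgs_bdd n)
  have hG : LipschitzWith 1 (supFunctional g) := supF_lip hab hg_bdd
  let ν : ℕ → ProbabilityMeasure ℝ := fun n =>
    (μs n).map (hF n).continuous.measurable.aemeasurable
  let ν0 : ProbabilityMeasure ℝ := μ.map hG.continuous.measurable.aemeasurable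
  have key : Tendsto ν atTop (𝓝 ν0) := by
    rw [tendsto_iff_forall_lipschitz_integral_tendsto]
    rintro f ⟨C, hC⟩ ⟨L, hL⟩
    have e0 : ∫ x, f x ∂(ν0 : Measure ℝ) = ∫ X, f (supFunctional g X) ∂(μ : Measure _) :=
      integral_map hG.continuous.measurable.aemeasurable
        hL.continuous.aestronglyMeasurable
    have e : ∀ n, ∫ x, f x ∂(ν n : Measure ℝ)
        = ∫ X, f (supFunctional (gs n) X) ∂(μs n : Measure _) := fun n =>
      integral_map (hF n).continuous.measurable.aemeasurable
        hL.continuous.aestronglyMeasurable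
    simp only [e, e0]
    let fb : ℝ →ᵇ ℝ := BoundedContinuousFunction.mkOfBound ⟨f, hL.continuous⟩ C hC
    have hlim : Tendsto (fun n => ∫ X, f (supFunctional g X) ∂(μs n : Measure _)) atTop
        (𝓝 (∫ X, f (supFunctional g X) ∂(μ : Measure _))) :=
      (ProbabilityMeasure.tendsto_iff_forall_integral_tendsto.1 hweak)
        (fb.compContinuous ⟨_, hG.continuous⟩)
    refine tendsto_of_tendsto_of_dist hlim ?_
    have hint : ∀ (h : Set.Icc a b → ℝ), LipschitzWith 1 (supFunctional h) → ∀ n,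
        Integrable (fun X => f (supFunctional h X)) (μs n : Measure _) := fun h hh n =>
      (fb.compContinuous ⟨_, hh.continuous⟩).integrable _
    rw [Metric.tendsto_nhds]
    intro ε hε
    have hδ : 0 < ε / (L + 1) / 2 := by positivity
    filter_upwards [Metric.tendstoUniformly_iff.1 hunif _ hδ] with n hn
    rw [Real.dist_eq, sub_zero, abs_of_nonneg dist_nonneg, dist_eq_norm,
      ← integral_sub (hint g hG n) (hint _ (hF n) n)]
    have hb : ∀ X, ‖f (supFunctional g X) - f (supFunctional (gs n) X)‖
        ≤ L * (ε / (L + 1) / 2) := fun X => by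
      rw [← dist_eq_norm]
      refine (hL.dist_le_mul _ _).trans ?_
      gcongr
      refine supF_close hab hg_bdd (hgs_bdd n) X _ fun τ => ?_
      rw [dist_comm]
      exact (hn τ).le
    have := norm_integral_le_of_norm_le_const (μ := (μs n : Measure C(Set.Icc a b, ℝ)))
      (Eventually.of_forall hb)
    refine this.trans_lt ?_
    rw [probReal_univ, mul_one]
    have hL0 : (0:ℝ) ≤ L := L.2
    have : (L:ℝ) * (ε / (L + 1) / 2) = (L / (L + 1)) * (ε / 2) := by ring
    rw [this]
    have : (L:ℝ) / (L + 1) ≤ 1 := (div_le_one (by positivity)).2 (by linarith)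
    nlinarith
  intro φ
  have := ProbabilityMeasure.tendsto_iff_forall_integral_tendsto.1 key φ
  have e0 : ∫ x, φ x ∂(ν0 : Measure ℝ) = ∫ X, φ (supFunctional g X) ∂(μ : Measure _) :=
    integral_map hG.continuous.measurable.aemeasurable φ.continuous.aestronglyMeasurable
  have e : ∀ n, ∫ x, φ x ∂(ν n : Measure ℝ)
      = ∫ X, φ (supFunctional (gs n) X) ∂(μs n : Measure _) := fun n =>
    integral_map (hF n).continuous.measurable.aemeasurable φ.continuous.aestronglyMeasurable
  simpa only [e, e0] using this
end

section
/- Let 0 ≤ v < 1 and c > 0 with v + c ≤ 1. Let ŝ be a real number with −1 < ŝ < −1 + 2v + 2√(c(1−v)), and set 𝔞 = ((1−ŝ)/2)². Then for all α₀ ∈ [𝔞, 1] one has the strict inequality α₀ − (1−ŝ)√α₀ > ŝ − c − v(1−α₀). -/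
/-- Let `0 ≤ v < 1`, `c > 0`, `v + c ≤ 1`, and `−1 < ŝ < −1 + 2v + 2√(c(1−v))`.
With `𝔞 = ((1−ŝ)/2)²`, for all `α₀ ∈ [𝔞, 1]` one has
`α₀ − (1−ŝ)√α₀ > ŝ − c − v(1−α₀)`. -/
theorem wall_not_catching_inequality (v c s : ℝ)
    (hv0 : 0 ≤ v) (hv1 : v < 1) (hc : 0 < c) (hvc : v + c ≤ 1)
    (hs1 : -1 < s) (hs2 : s < -1 + 2 * v + 2 * Real.sqrt (c * (1 - v)))
    (α₀ : ℝ) (hα : α₀ ∈ Set.Icc (((1 - s) / 2) ^ 2) 1) :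
    α₀ - (1 - s) * Real.sqrt α₀ > s - c - v * (1 - α₀) := by
  obtain ⟨h1, h2⟩ := hα
  have hα0 : 0 ≤ α₀ := le_trans (sq_nonneg _) h1
  have hx1 : Real.sqrt α₀ ≤ 1 := Real.sqrt_le_one.mpr h2
  have hx2 : α₀ = Real.sqrt α₀ ^ 2 := (Real.sq_sqrt hα0).symm
  have hw : 0 < 1 - v := by linarith
  have hr : Real.sqrt (c * (1 - v)) ^ 2 = c * (1 - v) := Real.sq_sqrt (by positivity)
  generalize Real.sqrt (c * (1 - v)) = r at *
  generalize Real.sqrt α₀ = x at *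
  subst hx2
  rcases hx1.eq_or_lt with rfl | hx
  · linarith
  · have key : 0 ≤ (1 - v) * (1 - x) ^ 2 - 2 * r * (1 - x) + c := by
      refine le_of_mul_le_mul_left ?_ hw
      nlinarith [sq_nonneg ((1 - v) * (1 - x) - r)]
    nlinarith [mul_pos (sub_pos.mpr hx) (sub_pos.mpr hs2)]
end

section
/- Let 0 ≤ v < 1 and c > 0. Let ŝ be a real number with −1 + 2v + 2√(c(1−v)) < ŝ < 1, and set 𝔞 = ((1−ŝ)/2)². Then there exists α₀ ∈ [𝔞, 1) such that α₀ − (1−ŝ)√α₀ < ŝ − c − v(1−α₀). -/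
/-- Let `0 ≤ v < 1`, `c > 0`, and `−1 + 2v + 2√(c(1−v)) < ŝ < 1`.
With `𝔞 = ((1−ŝ)/2)²`, there exists `α₀ ∈ [𝔞, 1)` such that
`α₀ − (1−ŝ)√α₀ < ŝ − c − v(1−α₀)`. -/
theorem wall_catching_inequality (v c s : ℝ)
    (hv0 : 0 ≤ v) (hv1 : v < 1) (hc : 0 < c)
    (hs1 : -1 + 2 * v + 2 * Real.sqrt (c * (1 - v)) < s) (hs2 : s < 1) :
    ∃ α₀ ∈ Set.Ico (((1 - s) / 2) ^ 2) 1,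
      α₀ - (1 - s) * Real.sqrt α₀ < s - c - v * (1 - α₀) := by
  have hw : 0 < 1 - v := by linarith
  have hr0 := Real.sqrt_nonneg (c * (1 - v))
  have hr := Real.sq_sqrt (mul_pos hc hw).le
  set r := Real.sqrt (c * (1 - v)) with hrdef
  obtain ⟨x, hx⟩ : ∃ x, x = (1 - s) / (2 * (1 - v)) := ⟨_, rfl⟩
  have hxe : 2 * (1 - v) * x = 1 - s := by rw [hx]; field_simp
  have hx0 : 0 < x := by rw [hx]; apply div_pos <;> linarith
  have hx1 : x < 1 := by rw [hx, div_lt_one (by linarith)]; linarith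
  have hxa : (1 - s) / 2 ≤ x := by nlinarith
  have hkey : r < (1 - v) * (1 - x) := by nlinarith
  have hsq : c * (1 - v) < ((1 - v) * (1 - x)) ^ 2 := by
    rw [← hr]; exact pow_lt_pow_left₀ hkey hr0 two_ne_zero
  have hc2 : c < (1 - v) * (1 - x) ^ 2 := by
    apply lt_of_mul_lt_mul_right _ hw.le
    calc c * (1 - v) < _ := hsq
      _ = _ := by ring
  refine ⟨x ^ 2, ⟨pow_le_pow_left₀ (by linarith) hxa 2, by nlinarith⟩, ?_⟩
  rw [Real.sqrt_sq hx0.le]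
  have hse : s = 1 - 2 * (1 - v) * x := by linarith
  rw [hse]
  nlinarith
end
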